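/- Let A : ℝ → ℝ^{d×d} take values in the symmetric positive definite matrices and be differentiable at a point t ∈ ℝ, and let α ∈ [1/2, 1). Then the function s ↦ A(s)^α is differentiable at t and |A'(t)| ≤ 2 |A(t)^{1−α} · (A^α)'(t)|, where the product inside the norm on the right-hand side is the matrix product and |·| is the Frobenius norm. -/

import Mathlib

open Matrix

/-- The Frobenius inner product `A·B := ∑ i j, A i j * B i j` of two real matrices. -/
noncomputable def fip {d : ℕ} (A B : Matrix (Fin d) (Fin d) ℝ) : ℝ :=
  ∑ i, ∑ j, A i j * B i j

/-- The Frobenius norm `|A| := √(A·A)` of a real matrix. -/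
noncomputable def fnorm {d : ℕ} (A : Matrix (Fin d) (Fin d) ℝ) : ℝ :=
  Real.sqrt (fip A A)

/-- The real power `A^α` of a (symmetric) real matrix, defined through the spectral
decomposition via the continuous functional calculus. -/
noncomputable def mpow {d : ℕ} (A : Matrix (Fin d) (Fin d) ℝ) (α : ℝ) :
    Matrix (Fin d) (Fin d) ℝ :=
  cfc (fun x : ℝ => x ^ α) A

/-- The matrix logarithm of a (symmetric positive definite) real matrix, defined
spectrally via the continuous functional calculus. -/
noncomputable def mlog {d : ℕ} (A : Matrix (Fin d) (Fin d) ℝ) :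
    Matrix (Fin d) (Fin d) ℝ :=
  cfc Real.log A

attribute [local instance] Matrix.frobeniusSeminormedAddCommGroup
  Matrix.frobeniusNormedAddCommGroup Matrix.frobeniusNormedSpace

open Polynomial in
theorem exists_polynomial_eval_eq_and_derivative_eval_eq (s : Finset ℝ) (a b : ℝ → ℝ) :
    ∃ p : ℝ[X], ∀ x ∈ s, p.eval x = a x ∧ p.derivative.eval x = b x := by
  have hs : Set.InjOn (id : ℝ → ℝ) s := Function.injective_id.injOn
  set q := Lagrange.interpolate s id a
  set N := Lagrange.nodal s (id : ℝ → ℝ)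
  set r := Lagrange.interpolate s id
    fun x => (b x - q.derivative.eval x) / N.derivative.eval x
  refine ⟨q + r * N, fun x hx => ?_⟩
  have hq : q.eval x = a x := Lagrange.eval_interpolate_at_node a hs hx
  have hr : r.eval x = (b x - q.derivative.eval x) / N.derivative.eval x :=
    Lagrange.eval_interpolate_at_node _ hs hx
  have hN : N.eval x = 0 := Lagrange.eval_nodal_at_node (v := id) hx
  have hN' : N.derivative.eval x ≠ 0 := by
    have := Lagrange.eval_nodal_derivative_eval_node_eq (v := (id : ℝ → ℝ)) hx
    rw [id] at this
    rw [this]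
    exact Lagrange.eval_nodal_not_at_node fun y hy => (Finset.ne_of_mem_erase hy).symm
  constructor
  · simp [hq, hN]
  · simp [hN, hr]
    field_simp
    ring

theorem fip_self_nonneg {d : ℕ} (X : Matrix (Fin d) (Fin d) ℝ) : 0 ≤ fip X X :=
  Finset.sum_nonneg fun _ _ => Finset.sum_nonneg fun _ _ => mul_self_nonneg _

theorem norm_eq_fnorm {d : ℕ} (X : Matrix (Fin d) (Fin d) ℝ) : ‖X‖ = fnorm X := by
  rw [Matrix.frobenius_norm_def, fnorm, fip, Real.sqrt_eq_rpow]
  simp [← sq]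

theorem norm_sq_eq_fip {d : ℕ} (X : Matrix (Fin d) (Fin d) ℝ) : ‖X‖ ^ 2 = fip X X := by
  rw [norm_eq_fnorm, fnorm, Real.sq_sqrt (fip_self_nonneg X)]

theorem fip_eq_trace {d : ℕ} (X Y : Matrix (Fin d) (Fin d) ℝ) : fip X Y = (star X * Y).trace := by
  simp only [fip, Matrix.trace, Matrix.diag, Matrix.mul_apply, Matrix.star_apply, star_trivial]
  exact Finset.sum_comm

theorem fip_star_mul_mul_self {d : ℕ} {U V : Matrix (Fin d) (Fin d) ℝ}
    (hU : U * star U = 1) (hV : V * star V = 1) (X : Matrix (Fin d) (Fin d) ℝ) :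
    fip (star U * X * V) (star U * X * V) = fip X X := by
  rw [fip_eq_trace, fip_eq_trace]
  calc (star (star U * X * V) * (star U * X * V)).trace
      = (star V * (star X * (U * star U) * X * V)).trace := by
        simp only [star_mul, star_star, Matrix.mul_assoc]
    _ = (star X * X * (V * star V)).trace := by
        rw [Matrix.trace_mul_comm, hU]
        simp only [Matrix.mul_assoc, Matrix.one_mul]
    _ = (star X * X).trace := by rw [hV, Matrix.mul_one]

theorem Matrix.IsHermitian.star_mul_cfc_mul {d : ℕ} {B C : Matrix (Fin d) (Fin d) ℝ}
    (hB : B.IsHermitian) (hC : C.IsHermitian) (g h : ℝ → ℝ) (i j : Fin d) :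
    (star (hB.eigenvectorUnitary : Matrix (Fin d) (Fin d) ℝ) * (cfc g B - cfc h C) *
      (hC.eigenvectorUnitary : Matrix (Fin d) (Fin d) ℝ)) i j =
    (g (hB.eigenvalues i) - h (hC.eigenvalues j)) *
      (star (hB.eigenvectorUnitary : Matrix (Fin d) (Fin d) ℝ) *
        (hC.eigenvectorUnitary : Matrix (Fin d) (Fin d) ℝ)) i j := by
  set U := (hB.eigenvectorUnitary : Matrix (Fin d) (Fin d) ℝ) with hU
  set V := (hC.eigenvectorUnitary : Matrix (Fin d) (Fin d) ℝ) with hV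
  have hU1 : star U * U = 1 := Unitary.coe_star_mul_self _
  have hV1 : star V * V = 1 := Unitary.coe_star_mul_self _
  have e : star U * (cfc g B - cfc h C) * V =
      diagonal (g ∘ hB.eigenvalues) * (star U * V) -
        (star U * V) * diagonal (h ∘ hC.eigenvalues) := by
    rw [hB.cfc_eq, hC.cfc_eq, Matrix.IsHermitian.cfc, Matrix.IsHermitian.cfc,
      Unitary.conjStarAlgAut_apply, Unitary.conjStarAlgAut_apply, ← hU, ← hV, Matrix.mul_sub,
      Matrix.sub_mul]
    congr 1
    · simp only [← Matrix.mul_assoc, hU1, Matrix.one_mul]; rfl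
    · simp only [Matrix.mul_assoc, hV1, Matrix.mul_one]; rfl
  rw [e, Matrix.sub_apply, Matrix.diagonal_mul, Matrix.mul_diagonal]
  simp only [Function.comp]
  ring

theorem Matrix.IsHermitian.star_mul_sub_mul {d : ℕ} {B C : Matrix (Fin d) (Fin d) ℝ}
    (hB : B.IsHermitian) (hC : C.IsHermitian) (i j : Fin d) :
    (star (hB.eigenvectorUnitary : Matrix (Fin d) (Fin d) ℝ) * (B - C) *
      (hC.eigenvectorUnitary : Matrix (Fin d) (Fin d) ℝ)) i j =
    (hB.eigenvalues i - hC.eigenvalues j) *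
      (star (hB.eigenvectorUnitary : Matrix (Fin d) (Fin d) ℝ) *
        (hC.eigenvectorUnitary : Matrix (Fin d) (Fin d) ℝ)) i j := by
  have h := hB.star_mul_cfc_mul hC id id i j
  have h1 : cfc id B = B := cfc_id ℝ B hB
  have h2 : cfc id C = C := cfc_id ℝ C hC
  rwa [h1, h2] at h

theorem Matrix.IsHermitian.norm_sub_sq {d : ℕ} {B C : Matrix (Fin d) (Fin d) ℝ}
    (hB : B.IsHermitian) (hC : C.IsHermitian) :
    ‖B - C‖ ^ 2 = ∑ i, ∑ j, (hB.eigenvalues i - hC.eigenvalues j) ^ 2 *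
      (star (hB.eigenvectorUnitary : Matrix (Fin d) (Fin d) ℝ) *
        (hC.eigenvectorUnitary : Matrix (Fin d) (Fin d) ℝ)) i j ^ 2 := by
  rw [norm_sq_eq_fip, ← fip_star_mul_mul_self (Unitary.coe_mul_star_self hB.eigenvectorUnitary)
    (Unitary.coe_mul_star_self hC.eigenvectorUnitary), fip]
  simp only [hB.star_mul_sub_mul hC]
  exact Finset.sum_congr rfl fun i _ => Finset.sum_congr rfl fun j _ => by ring

theorem Matrix.IsHermitian.exists_abs_eigenvalues_sub_le {d : ℕ}
    {B C : Matrix (Fin d) (Fin d) ℝ} (hB : B.IsHermitian) (hC : C.IsHermitian) (j : Fin d) :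
    ∃ i, |hB.eigenvalues i - hC.eigenvalues j| ≤ ‖B - C‖ := by
  set W := star (hB.eigenvectorUnitary : Matrix (Fin d) (Fin d) ℝ) *
    (hC.eigenvectorUnitary : Matrix (Fin d) (Fin d) ℝ) with hW
  have hW1 : star W * W = 1 := by
    have h1 := Unitary.coe_mul_star_self hB.eigenvectorUnitary
    have h2 := Unitary.coe_star_mul_self hC.eigenvectorUnitary
    rw [Unitary.coe_star] at h1
    rw [hW, star_mul, star_star, Matrix.mul_assoc, ← Matrix.mul_assoc _ (star _), h1,
      Matrix.one_mul]
    exact h2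
  have hcol : ∑ i, W i j ^ 2 = 1 := by
    have := congrFun (congrFun hW1 j) j
    rw [Matrix.mul_apply, Matrix.one_apply_eq] at this
    rw [← this]
    exact Finset.sum_congr rfl fun i _ => by simp [Matrix.star_apply, sq]
  by_contra! h
  have hlt : ‖B - C‖ ^ 2 < ‖B - C‖ ^ 2 := by
    have hpos : ∃ i, 0 < W i j ^ 2 := by
      by_contra! h0
      have := Finset.sum_nonpos fun i (_ : i ∈ Finset.univ) => h0 i
      linarith
    obtain ⟨k, hk⟩ := hpos
    have hsq : ∀ i, ‖B - C‖ ^ 2 < (hB.eigenvalues i - hC.eigenvalues j) ^ 2 := fun i => by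
      rw [← sq_abs (hB.eigenvalues i - hC.eigenvalues j)]
      exact pow_lt_pow_left₀ (h i) (norm_nonneg _) two_ne_zero
    calc ‖B - C‖ ^ 2 = ∑ i, ‖B - C‖ ^ 2 * W i j ^ 2 := by
          rw [← Finset.mul_sum, hcol, mul_one]
      _ < ∑ i, (hB.eigenvalues i - hC.eigenvalues j) ^ 2 * W i j ^ 2 :=
          Finset.sum_lt_sum
            (fun i _ => mul_le_mul_of_nonneg_right (hsq i).le (sq_nonneg _))
            ⟨k, Finset.mem_univ _, mul_lt_mul_of_pos_right (hsq k) hk⟩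
      _ ≤ ‖B - C‖ ^ 2 := by
          rw [hB.norm_sub_sq hC]
          exact Finset.sum_le_sum fun i _ => Finset.single_le_sum
            (f := fun j => (hB.eigenvalues i - hC.eigenvalues j) ^ 2 * W i j ^ 2)
            (fun j _ => by positivity) (Finset.mem_univ j)
  exact lt_irrefl _ hlt

theorem Matrix.IsHermitian.norm_cfc_sub_cfc_le {d : ℕ} {B C : Matrix (Fin d) (Fin d) ℝ}
    (hB : B.IsHermitian) (hC : C.IsHermitian) (g : ℝ → ℝ) {ε : ℝ} (hε : 0 ≤ ε)
    (h : ∀ i j, |g (hB.eigenvalues i) - g (hC.eigenvalues j)| ≤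
      ε * |hB.eigenvalues i - hC.eigenvalues j|) :
    ‖cfc g B - cfc g C‖ ≤ ε * ‖B - C‖ := by
  refine le_of_sq_le_sq ?_ (by positivity)
  rw [mul_pow, hB.norm_sub_sq hC, norm_sq_eq_fip,
    ← fip_star_mul_mul_self (Unitary.coe_mul_star_self hB.eigenvectorUnitary)
    (Unitary.coe_mul_star_self hC.eigenvectorUnitary), fip, Finset.mul_sum]
  simp only [hB.star_mul_cfc_mul hC, Finset.mul_sum]
  refine Finset.sum_le_sum fun i _ => Finset.sum_le_sum fun j _ => ?_
  have h2 := pow_le_pow_left₀ (abs_nonneg _) (h i j) 2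
  rw [mul_pow, sq_abs, sq_abs] at h2
  rw [← sq, mul_pow, ← mul_assoc]
  exact mul_le_mul_of_nonneg_right h2 (sq_nonneg _)

open Filter Topology in
theorem hasDerivAt_cfc_zero {d : ℕ} {A : ℝ → Matrix (Fin d) (Fin d) ℝ}
    {A' : Matrix (Fin d) (Fin d) ℝ} {t : ℝ} (hA : ∀ s, (A s).IsHermitian)
    (hdiff : HasDerivAt A A' t) {g : ℝ → ℝ} (hg : ∀ i, g ((hA t).eigenvalues i) = 0)
    (hg' : ∀ i, HasDerivAt g 0 ((hA t).eigenvalues i)) :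
    HasDerivAt (fun s => cfc g (A s)) 0 t := by
  refine hasDerivAt_iff_isLittleO.2 ?_
  simp only [smul_zero, sub_zero]
  refine Asymptotics.IsLittleO.trans_isBigO ?_ hdiff.isBigO_sub
  rw [Asymptotics.isLittleO_iff]
  intro ε hε
  have hloc : ∀ i, ∃ δ > 0, ∀ x, |x - (hA t).eigenvalues i| < δ →
      |g x| ≤ ε * |x - (hA t).eigenvalues i| := fun i => by
    have h := hg' i
    rw [hasDerivAt_iff_isLittleO, Asymptotics.isLittleO_iff] at h
    obtain ⟨δ, hδ, h⟩ := Metric.eventually_nhds_iff.1 (h hε)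
    refine ⟨δ, hδ, fun x hx => ?_⟩
    simpa [hg i] using h hx
  choose δ hδ hloc using hloc
  obtain ⟨η, hη, hηδ⟩ : ∃ η > 0, ∀ i, η ≤ δ i := by
    rcases isEmpty_or_nonempty (Fin d) with _ | _
    · exact ⟨1, one_pos, isEmptyElim⟩
    · obtain ⟨k, hk⟩ := Finite.exists_min δ
      exact ⟨δ k, hδ k, hk⟩
  filter_upwards [Metric.continuousAt_iff'.1 hdiff.continuousAt η hη] with s hs
  rw [dist_comm, dist_eq_norm] at hs
  rw [norm_sub_rev, norm_sub_rev (A s)]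
  refine (hA t).norm_cfc_sub_cfc_le (hA s) g hε.le fun i j => ?_
  have : Nonempty (Fin d) := ⟨j⟩
  obtain ⟨k, hk⟩ := Finite.exists_min
    fun i => |(hA t).eigenvalues i - (hA s).eigenvalues j|
  obtain ⟨l, hl⟩ := (hA t).exists_abs_eigenvalues_sub_le (hA s) j
  rw [hg i, zero_sub, abs_neg]
  refine (hloc k _ ?_).trans ?_
  · rw [abs_sub_comm]
    exact ((hk l).trans hl).trans_lt (hs.trans_le (hηδ k))
  · rw [abs_sub_comm]
    exact mul_le_mul_of_nonneg_left (hk i) hε.le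

section Polynomial

attribute [local instance] Matrix.frobeniusNormedRing Matrix.frobeniusNormedAlgebra

open Polynomial in
theorem star_mul_aeval_mul {d : ℕ} {B U : Matrix (Fin d) (Fin d) ℝ} {l : Fin d → ℝ}
    (hU : U * star U = 1) (hl : star U * B * U = diagonal l) (p : ℝ[X]) :
    star U * aeval B p * U = diagonal fun i => p.eval (l i) := by
  have hU' : star U * U = 1 := mul_eq_one_comm.1 hU
  induction p using Polynomial.induction_on' with
  | add p q hp hq =>
    rw [map_add, Matrix.mul_add, Matrix.add_mul, hp, hq, Matrix.diagonal_add]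
    simp only [eval_add]
  | monomial n a =>
    induction n with
    | zero =>
      rw [monomial_zero_left, aeval_C, Algebra.algebraMap_eq_smul_one, Matrix.mul_smul,
        Matrix.mul_one, Matrix.smul_mul, hU', Matrix.smul_one_eq_diagonal]
      simp only [eval_C]
    | succ n ih =>
      calc star U * aeval B (monomial (n + 1) a) * U
          = (star U * aeval B (monomial n a) * U) * (star U * B * U) := by
            rw [← monomial_mul_X, map_mul, aeval_X]
            simp only [Matrix.mul_assoc]
            simp only [← Matrix.mul_assoc U (star U), hU, Matrix.one_mul]
        _ = diagonal fun i => eval (l i) (monomial (n + 1) a) := by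
            rw [ih, hl, Matrix.diagonal_mul_diagonal, ← monomial_mul_X]
            simp only [eval_mul, eval_X]

open Polynomial in
theorem exists_hasDerivAt_aeval {d : ℕ} {A : ℝ → Matrix (Fin d) (Fin d) ℝ}
    {A' : Matrix (Fin d) (Fin d) ℝ} {t : ℝ} (hdiff : HasDerivAt A A' t)
    {U : Matrix (Fin d) (Fin d) ℝ} {l : Fin d → ℝ} (hU : U * star U = 1)
    (hl : star U * A t * U = diagonal l) (p : ℝ[X]) :
    ∃ D : Matrix (Fin d) (Fin d) ℝ, HasDerivAt (fun s => aeval (A s) p) D t ∧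
      ∀ i j, (l i - l j) * (star U * D * U) i j =
          (p.eval (l i) - p.eval (l j)) * (star U * A' * U) i j ∧
        (l i = l j → (star U * D * U) i j =
          p.derivative.eval (l i) * (star U * A' * U) i j) := by
  induction p using Polynomial.induction_on' with
  | add p q hp hq =>
    obtain ⟨D, hD, hp⟩ := hp
    obtain ⟨E, hE, hq⟩ := hq
    refine ⟨D + E, by simp only [map_add]; exact hD.add hE, fun i j => ⟨?_, fun hij => ?_⟩⟩
    · simp only [Matrix.mul_add, Matrix.add_mul, Matrix.add_apply, eval_add]
      linear_combination (hp i j).1 + (hq i j).1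
    · simp only [Matrix.mul_add, Matrix.add_mul, Matrix.add_apply, eval_add, derivative_add]
      linear_combination (hp i j).2 hij + (hq i j).2 hij
  | monomial n a =>
    induction n with
    | zero =>
      refine ⟨0, ?_, fun i j => by simp⟩
      simp only [monomial_zero_left, aeval_C]
      exact hasDerivAt_const t _
    | succ n ih =>
      obtain ⟨D, hD, h⟩ := ih
      have hpow : star U * aeval (A t) (monomial n a) * U =
          diagonal fun i => eval (l i) (monomial n a) :=
        star_mul_aeval_mul hU hl _
      refine ⟨D * A t + aeval (A t) (monomial n a) * A', ?_, fun i j => ?_⟩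
      · have e : ∀ s, aeval (A s) (monomial (n + 1) a) = aeval (A s) (monomial n a) * A s :=
          fun s => by rw [← monomial_mul_X, map_mul, aeval_X]
        simp only [e]
        exact hD.mul hdiff
      · have e : star U * (D * A t + aeval (A t) (monomial n a) * A') * U =
            (star U * D * U) * (star U * A t * U) +
              (star U * aeval (A t) (monomial n a) * U) * (star U * A' * U) := by
          simp only [Matrix.mul_add, Matrix.add_mul, Matrix.mul_assoc]
          simp only [← Matrix.mul_assoc U (star U), hU, Matrix.one_mul]
        rw [e, hl, hpow, Matrix.add_apply, Matrix.mul_diagonal, Matrix.diagonal_mul,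
          ← monomial_mul_X]
        obtain ⟨h1, h2⟩ := h i j
        refine ⟨?_, fun hij => ?_⟩
        · simp only [eval_mul, eval_X]
          linear_combination l j * h1
        · rw [h2 hij, derivative_mul, derivative_X]
          simp only [eval_mul, eval_X, eval_add, mul_one]
          rw [hij]
          ring

end Polynomial

theorem sq_sub_le_of_rpow {a b α : ℝ} (ha : 0 < a) (hb : 0 < b) (hα : 1 / 2 ≤ α) :
    (a - b) ^ 2 ≤
      2 * ((a ^ (1 - α)) ^ 2 + (b ^ (1 - α)) ^ 2) * (a ^ α - b ^ α) ^ 2 := by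
  wlog hab : b ≤ a generalizing a b
  · have := this hb ha (le_of_not_ge hab)
    linarith [this, sub_sq_comm a b, sub_sq_comm (a ^ α) (b ^ α)]
  have h1 : a ^ (1 - α) * a ^ α = a := by rw [← Real.rpow_add ha]; simp
  have h2 : b ^ (1 - α) * b ^ α = b := by rw [← Real.rpow_add hb]; simp
  have hx : 0 < a ^ (1 - α) := Real.rpow_pos_of_pos ha _
  have hy : 0 < b ^ (1 - α) := Real.rpow_pos_of_pos hb _
  have h3 : a ^ (1 - α) * b ^ α ≤ b ^ (1 - α) * a ^ α := by
    have e1 : a ^ α = a ^ (1 - α) * a ^ (2 * α - 1) := by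
      rw [← Real.rpow_add ha]; congr 1; ring
    have e2 : b ^ α = b ^ (1 - α) * b ^ (2 * α - 1) := by
      rw [← Real.rpow_add hb]; congr 1; ring
    have h4 : b ^ (2 * α - 1) ≤ a ^ (2 * α - 1) :=
      Real.rpow_le_rpow hb.le hab (by linarith)
    rw [e1, e2]
    nlinarith [mul_le_mul_of_nonneg_left h4 (mul_pos hx hy).le]
  have h5 : a - b ≤ (a ^ (1 - α) + b ^ (1 - α)) * (a ^ α - b ^ α) := by nlinarith
  calc (a - b) ^ 2 ≤ ((a ^ (1 - α) + b ^ (1 - α)) * (a ^ α - b ^ α)) ^ 2 :=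
        pow_le_pow_left₀ (sub_nonneg.2 hab) h5 2
    _ = (a ^ (1 - α) + b ^ (1 - α)) ^ 2 * (a ^ α - b ^ α) ^ 2 := mul_pow _ _ _
    _ ≤ _ := mul_le_mul_of_nonneg_right add_sq_le (sq_nonneg _)

/-- A form of the Daleckii–Krein theorem: in an eigenbasis of `A t`, the derivative of
`s ↦ f (A s)` is the entrywise product of the derivative of `A` with the divided differences
of `f`. -/
theorem exists_hasDerivAt_cfc {d : ℕ} {A : ℝ → Matrix (Fin d) (Fin d) ℝ}
    {A' : Matrix (Fin d) (Fin d) ℝ} {t : ℝ} (hA : ∀ s, (A s).IsHermitian)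
    (hdiff : HasDerivAt A A' t) {f f' : ℝ → ℝ}
    (hf : ∀ i, HasDerivAt f (f' ((hA t).eigenvalues i)) ((hA t).eigenvalues i))
    {U : Matrix (Fin d) (Fin d) ℝ} (hU : U = (hA t).eigenvectorUnitary)
    {l : Fin d → ℝ} (hl : l = (hA t).eigenvalues) :
    ∃ D : Matrix (Fin d) (Fin d) ℝ, HasDerivAt (fun s => cfc f (A s)) D t ∧
      ∀ i j, (l i - l j) * (star U * D * U) i j =
          (f (l i) - f (l j)) * (star U * A' * U) i j ∧
        (l i = l j → (star U * D * U) i j = f' (l i) * (star U * A' * U) i j) := by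
  obtain ⟨p, hp⟩ := exists_polynomial_eval_eq_and_derivative_eval_eq (Finset.univ.image l) f f'
  replace hp : ∀ i, p.eval (l i) = f (l i) ∧ p.derivative.eval (l i) = f' (l i) :=
    fun i => hp _ (Finset.mem_image_of_mem _ (Finset.mem_univ i))
  have hUU : U * star U = 1 := by
    rw [hU]; exact Unitary.coe_mul_star_self (hA t).eigenvectorUnitary
  have hdiag : star U * A t * U = diagonal l := by
    have := (hA t).conjStarAlgAut_star_eigenvectorUnitary
    rw [Unitary.conjStarAlgAut_star_apply] at this
    rw [hU, hl]
    exact this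
  obtain ⟨D, hD, hDij⟩ := exists_hasDerivAt_aeval hdiff hUU hdiag p
  refine ⟨D, ?_, fun i j => ?_⟩
  · have hg : HasDerivAt (fun s => cfc (fun x => f x - p.eval x) (A s)) 0 t := by
      refine hasDerivAt_cfc_zero hA hdiff (fun i => ?_) fun i => ?_
      · rw [← hl, (hp i).1, sub_self]
      · have h := (hf i).sub (p.hasDerivAt ((hA t).eigenvalues i))
        rw [← hl, (hp i).2, sub_self] at h
        rw [← hl]
        exact h
    have e : ∀ s, cfc f (A s) =
        cfc (fun x => f x - p.eval x) (A s) + Polynomial.aeval (A s) p := fun s => by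
      have h1 : cfc p.eval (A s) = Polynomial.aeval (A s) p := cfc_polynomial p (A s) (hA s)
      have hc : ∀ h : ℝ → ℝ, ContinuousOn h (spectrum ℝ (A s)) := fun h =>
        (Matrix.finite_real_spectrum (A := A s)).continuousOn h
      rw [← h1, cfc_sub f p.eval (A s) (hc _) (hc _), sub_add_cancel]
    simp only [e]
    have h := hg.add hD
    rw [zero_add] at h
    exact h
  · rw [← (hp i).1, ← (hp j).1, ← (hp i).2]
    exact hDij i j

theorem transpose_eq_of_hasDerivAt {d : ℕ} {A : ℝ → Matrix (Fin d) (Fin d) ℝ}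
    {A' : Matrix (Fin d) (Fin d) ℝ} {t : ℝ} (hA : ∀ s, (A s)ᵀ = A s)
    (hdiff : HasDerivAt A A' t) : A'ᵀ = A' := by
  have h : HasDerivAt (fun s => (A s)ᵀ) A'ᵀ t :=
    (Matrix.transposeLinearEquiv (Fin d) (Fin d) ℝ
      ℝ).toLinearMap.toContinuousLinearMap.hasFDerivAt.comp_hasDerivAt t hdiff
  simp only [hA] at h
  exact h.unique hdiff

theorem sum_sq_le_of_symm {d : ℕ} {M N : Matrix (Fin d) (Fin d) ℝ} {x : Fin d → ℝ}
    (hN : Nᵀ = N) (h : ∀ i j, M i j ^ 2 ≤ 2 * (x i ^ 2 + x j ^ 2) * N i j ^ 2) :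
    fip M M ≤ 2 ^ 2 * fip (diagonal x * N) (diagonal x * N) := by
  have hsymm : ∑ i, ∑ j, x j ^ 2 * N i j ^ 2 = ∑ i, ∑ j, x i ^ 2 * N i j ^ 2 := by
    rw [Finset.sum_comm]
    refine Finset.sum_congr rfl fun i _ => Finset.sum_congr rfl fun j _ => ?_
    rw [← hN, Matrix.transpose_apply, hN]
  calc fip M M = ∑ i, ∑ j, M i j ^ 2 := by simp only [fip, sq]
    _ ≤ ∑ i, ∑ j, 2 * (x i ^ 2 + x j ^ 2) * N i j ^ 2 :=
        Finset.sum_le_sum fun i _ => Finset.sum_le_sum fun j _ => h i j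
    _ = 2 * (∑ i, ∑ j, x i ^ 2 * N i j ^ 2) + 2 * ∑ i, ∑ j, x j ^ 2 * N i j ^ 2 := by
        simp only [Finset.mul_sum, ← Finset.sum_add_distrib]
        exact Finset.sum_congr rfl fun i _ => Finset.sum_congr rfl fun j _ => by ring
    _ = 2 ^ 2 * ∑ i, ∑ j, x i ^ 2 * N i j ^ 2 := by rw [hsymm]; ring
    _ = _ := by simp only [fip, Matrix.diagonal_mul, ← sq, mul_pow]

/-- If `A : ℝ → ℝ^{d×d}` takes symmetric positive definite values and is differentiable at
`t`, and `α ∈ [1/2, 1)`, then `s ↦ A(s)^α` is differentiable at `t` and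
`|A'(t)| ≤ 2 |A(t)^(1−α) * (A^α)'(t)|` (matrix product inside the Frobenius norm). -/
theorem fnorm_deriv_le_of_mpow {d : ℕ} (hd : 0 < d)
    (A : ℝ → Matrix (Fin d) (Fin d) ℝ) (hA : ∀ s, (A s).PosDef)
    (t : ℝ) (A' : Matrix (Fin d) (Fin d) ℝ) (hdiff : HasDerivAt A A' t)
    (α : ℝ) (hα : α ∈ Set.Ico (1 / 2 : ℝ) 1) :
    ∃ P' : Matrix (Fin d) (Fin d) ℝ,
      HasDerivAt (fun s => mpow (A s) α) P' t ∧
      fnorm A' ≤ 2 * fnorm (mpow (A t) (1 - α) * P') := by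
  have hH : ∀ s, (A s).IsHermitian := fun s => (hA s).isHermitian
  set U := ((hH t).eigenvectorUnitary : Matrix (Fin d) (Fin d) ℝ) with hU
  set l := (hH t).eigenvalues with hl
  have hpos : ∀ i, 0 < l i := (hA t).eigenvalues_pos
  obtain ⟨P', hP', hij⟩ := exists_hasDerivAt_cfc hH hdiff
    (f := fun x => x ^ α) (f' := fun x => α * x ^ (α - 1))
    (fun i => Real.hasDerivAt_rpow_const (Or.inl (hpos i).ne')) hU hl
  refine ⟨P', hP', ?_⟩
  have hUU : U * star U = 1 := Unitary.coe_mul_star_self (hH t).eigenvectorUnitary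
  have hUU' : star U * U = 1 := Unitary.coe_star_mul_self (hH t).eigenvectorUnitary
  have hP't : P'ᵀ = P' := transpose_eq_of_hasDerivAt
    (fun s => (cfc_predicate (fun x : ℝ => x ^ α) (A s) : IsSelfAdjoint _)) hP'
  have hN : (star U * P' * U)ᵀ = star U * P' * U := by
    rw [Matrix.transpose_mul, Matrix.transpose_mul, hP't, ← Matrix.mul_assoc]
    rfl
  have hmul : star U * (mpow (A t) (1 - α) * P') * U =
      diagonal (fun i => l i ^ (1 - α)) * (star U * P' * U) := by
    rw [mpow, (hH t).cfc_eq, Matrix.IsHermitian.cfc, Unitary.conjStarAlgAut_apply, ← hU]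
    simp only [← Matrix.mul_assoc, hUU', Matrix.one_mul]
    rfl
  rw [fnorm, fnorm, ← fip_star_mul_mul_self hUU hUU A',
    ← fip_star_mul_mul_self hUU hUU (mpow (A t) (1 - α) * P'), hmul]
  refine Real.sqrt_le_iff.2 ⟨by positivity, ?_⟩
  rw [mul_pow, Real.sq_sqrt (fip_self_nonneg _)]
  refine sum_sq_le_of_symm hN fun i j => ?_
  obtain ⟨h1, h2⟩ := hij i j
  by_cases hlij : l i = l j
  · have hx : l i ^ (1 - α) * l i ^ (α - 1) = 1 := by
      rw [← Real.rpow_add (hpos i)]; simp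
    rw [h2 hlij, ← hlij]
    have e : 2 * ((l i ^ (1 - α)) ^ 2 + (l i ^ (1 - α)) ^ 2) *
        (α * l i ^ (α - 1) * (star U * A' * U) i j) ^ 2 =
        4 * α ^ 2 * (l i ^ (1 - α) * l i ^ (α - 1)) ^ 2 * (star U * A' * U) i j ^ 2 := by ring
    rw [e, hx]
    have hα' : 1 ≤ 4 * α ^ 2 := by nlinarith [hα.1]
    nlinarith [sq_nonneg ((star U * A' * U) i j)]
  · have hlt : 0 < (l i - l j) ^ 2 := sq_pos_of_ne_zero (sub_ne_zero.2 hlij)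
    refine le_of_mul_le_mul_left ?_ hlt
    calc (l i - l j) ^ 2 * (star U * A' * U) i j ^ 2
        ≤ 2 * ((l i ^ (1 - α)) ^ 2 + (l j ^ (1 - α)) ^ 2) * (l i ^ α - l j ^ α) ^ 2 *
          (star U * A' * U) i j ^ 2 :=
          mul_le_mul_of_nonneg_right (sq_sub_le_of_rpow (hpos i) (hpos j) hα.1) (sq_nonneg _)
      _ = 2 * ((l i ^ (1 - α)) ^ 2 + (l j ^ (1 - α)) ^ 2) *
          ((l i ^ α - l j ^ α) * (star U * A' * U) i j) ^ 2 := by ring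
      _ = (l i - l j) ^ 2 * (2 * ((l i ^ (1 - α)) ^ 2 + (l j ^ (1 - α)) ^ 2) *
          (star U * P' * U) i j ^ 2) := by rw [← h1]; ring
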